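/- arXiv:1104.0262 — 2 statements merged into one kernel-verified Lean document; each statement's English description precedes it below -/
import Mathlib

section
/- Consider the linearized Bregman iteration with data A, f, μ, δ. Assume that A Aᵀ is invertible (equivalently, A has full row rank). If the sequence (u^k) converges to a limit u^∞ ∈ ℝⁿ, then A u^∞ = f. -/
open Filter Matrix

noncomputable section

/-- Soft-thresholding (shrink) operator on ℝ: `x-μ` if `x>μ`, `0` if `-μ ≤ x ≤ μ`,
`x+μ` if `x < -μ`. -/
def shrink (x μ : ℝ) : ℝ :=
  if μ < x then x - μ else if x < -μ then x + μ else 0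

/-- Componentwise shrink on ℝⁿ. -/
def shrinkVec {n : ℕ} (v : Fin n → ℝ) (μ : ℝ) : Fin n → ℝ :=
  fun i => shrink (v i) μ

/-- Euclidean norm on ℝⁿ. -/
def enorm {n : ℕ} (x : Fin n → ℝ) : ℝ :=
  Real.sqrt (∑ i, x i ^ 2)

/-- ℓ¹ norm on ℝⁿ. -/
def l1norm {n : ℕ} (x : Fin n → ℝ) : ℝ := ∑ i, |x i|

/-- Operator (spectral) norm of a square real matrix, w.r.t. Euclidean norms. -/
def opNorm {m : ℕ} (M : Matrix (Fin m) (Fin m) ℝ) : ℝ :=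
  ‖LinearMap.toContinuousLinearMap (Matrix.toEuclideanLin M)‖

/-- The linearized Bregman iteration with data `A`, `f`, `μ`, `δ`:
`u⁰ = v⁰ = 0`, `v^{k+1} = v^k + Aᵀ(f - A u^k)`, `u^{k+1} = δ·shrink(v^{k+1}, μ)`. -/
def LBI {m n : ℕ} (A : Matrix (Fin m) (Fin n) ℝ) (f : Fin m → ℝ) (μ δ : ℝ)
    (u v : ℕ → Fin n → ℝ) : Prop :=
  u 0 = 0 ∧ v 0 = 0 ∧
    (∀ k, v (k + 1) = v k + Aᵀ.mulVec (f - A.mulVec (u k))) ∧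
    (∀ k, u (k + 1) = δ • shrinkVec (v (k + 1)) μ)

/-- Soft-thresholding moves a point by at most the threshold. -/
lemma abs_le_abs_shrink_add (x : ℝ) {μ : ℝ} (hμ : 0 < μ) : |x| ≤ |shrink x μ| + μ := by
  unfold shrink
  split_ifs <;> grind

/-- A bounded real sequence whose increments converge has increments tending to zero. -/
lemma eq_zero_of_tendsto_sub_of_bounded {a : ℕ → ℝ} {l C : ℝ} (hC : ∀ k, |a k| ≤ C)
    (h : Tendsto (fun k => a (k + 1) - a k) atTop (nhds l)) : l = 0 := by
  have hcesaro := h.cesaro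
  simp only [Finset.sum_range_sub] at hcesaro
  refine tendsto_nhds_unique hcesaro ?_
  refine tendsto_inv_atTop_nhds_zero_nat.zero_mul_isBoundedUnder_le ?_
  refine isBoundedUnder_of ⟨C + C, fun k => ?_⟩
  exact (abs_sub _ _).trans (add_le_add (hC k) (hC 0))

theorem lbi_limit_satisfies_constraint {m n : ℕ}
    (A : Matrix (Fin m) (Fin n) ℝ) (f : Fin m → ℝ) (μ δ : ℝ)
    (hμ : 0 < μ) (hδ : 0 < δ) (hA : IsUnit (A * Aᵀ))
    (u v : ℕ → Fin n → ℝ) (hLBI : LBI A f μ δ u v)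
    (uInf : Fin n → ℝ) (hconv : Tendsto u atTop (nhds uInf)) :
    A.mulVec uInf = f := by
  obtain ⟨-, -, hv, hu⟩ := hLBI
  have hres : Aᵀ.mulVec (f - A.mulVec uInf) = 0 := by
    have hmul {p q : ℕ} (M : Matrix (Fin p) (Fin q) ℝ) : Continuous M.mulVec := by
      fun_prop
    have hlim : Tendsto (fun k => Aᵀ.mulVec (f - A.mulVec (u k))) atTop
        (nhds (Aᵀ.mulVec (f - A.mulVec uInf))) :=
      (((hmul Aᵀ).comp (continuous_const.sub (hmul A))).tendsto uInf).comp hconv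
    funext i
    have hui : Tendsto (fun k => u k i) atTop (nhds (uInf i)) := tendsto_pi_nhds.1 hconv i
    obtain ⟨C, hC⟩ := hui.abs.bddAbove_range
    have hbound (k : ℕ) : |v (k + 1) i| ≤ C / δ + μ := by
      refine (abs_le_abs_shrink_add _ hμ).trans (add_le_add_left ?_ μ)
      have hk : |u (k + 1) i| ≤ C := hC ⟨k + 1, rfl⟩
      rw [hu, Pi.smul_apply, smul_eq_mul, abs_mul, abs_of_pos hδ] at hk
      rwa [le_div_iff₀' hδ]
    refine eq_zero_of_tendsto_sub_of_bounded hbound ?_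
    refine ((tendsto_pi_nhds.1 hlim i).comp (tendsto_add_atTop_nat 1)).congr fun k => ?_
    simp [hv (k + 1)]
  have hgram : (A * Aᵀ).mulVec (f - A.mulVec uInf) = (A * Aᵀ).mulVec 0 := by
    rw [← Matrix.mulVec_mulVec, hres, Matrix.mulVec_zero, Matrix.mulVec_zero]
  exact (sub_eq_zero.1 (Matrix.mulVec_injective_of_isUnit hA hgram)).symm

end
end

section
/- Consider the linearized Bregman iteration with data A, f, μ, δ. For every k there exists an n×n diagonal matrix Q^k whose diagonal entries all lie in [0,1] such that u^{k+1} − u^k = δ·Q^k·Aᵀ(f − A u^k), and consequently the residuals satisfy the recursion A u^{k+1} − f = (I − δ·A Q^k Aᵀ)(A u^k − f). -/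
open Filter Matrix

noncomputable section

lemma exists_shrink_add_sub_shrink {μ : ℝ} (hμ : 0 < μ) (x d : ℝ) :
    ∃ q ∈ Set.Icc (0 : ℝ) 1, shrink (x + d) μ - shrink x μ = q * d := by
  rcases lt_trichotomy d 0 with hd | rfl | hd
  · refine ⟨(shrink (x + d) μ - shrink x μ) / d, ⟨?_, ?_⟩, (div_mul_cancel₀ _ hd.ne).symm⟩
    · apply div_nonneg_of_nonpos _ hd.le
      unfold shrink
      split_ifs <;> linarith
    · rw [div_le_one_of_neg hd]
      unfold shrink
      split_ifs <;> linarith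
  · exact ⟨0, by simp, by simp⟩
  · refine ⟨(shrink (x + d) μ - shrink x μ) / d, ⟨?_, ?_⟩, (div_mul_cancel₀ _ hd.ne').symm⟩
    · apply div_nonneg _ hd.le
      unfold shrink
      split_ifs <;> linarith
    · rw [div_le_one hd]
      unfold shrink
      split_ifs <;> linarith

lemma LBI.eq_smul_shrinkVec {m n : ℕ} {A : Matrix (Fin m) (Fin n) ℝ} {f : Fin m → ℝ}
    {μ δ : ℝ} {u v : ℕ → Fin n → ℝ} (h : LBI A f μ δ u v) (hμ : 0 < μ) (k : ℕ) :
    u k = δ • shrinkVec (v k) μ := by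
  obtain ⟨hu, hv, -, hstep⟩ := h
  cases k with
  | zero =>
    ext i
    simp [hu, hv, shrinkVec, shrink, hμ.not_gt]
  | succ k => exact hstep k

theorem lbi_diagonal_representation {m n : ℕ}
    (A : Matrix (Fin m) (Fin n) ℝ) (f : Fin m → ℝ) (μ δ : ℝ)
    (hμ : 0 < μ) (hδ : 0 < δ)
    (u v : ℕ → Fin n → ℝ) (hLBI : LBI A f μ δ u v) :
    ∀ k : ℕ, ∃ q : Fin n → ℝ, (∀ i, q i ∈ Set.Icc (0 : ℝ) 1) ∧
      u (k + 1) - u k =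
        δ • (Matrix.diagonal q).mulVec (Aᵀ.mulVec (f - A.mulVec (u k))) ∧
      A.mulVec (u (k + 1)) - f =
        ((1 : Matrix (Fin m) (Fin m) ℝ) - δ • (A * Matrix.diagonal q * Aᵀ)).mulVec
          (A.mulVec (u k) - f) := by
  intro k
  have hstep : v (k + 1) = v k + Aᵀ.mulVec (f - A.mulVec (u k)) := hLBI.2.2.1 k
  choose q hq hshrink using fun i =>
    exists_shrink_add_sub_shrink hμ (v k i) (Aᵀ.mulVec (f - A.mulVec (u k)) i)
  have hdiff : u (k + 1) - u k =
      δ • (Matrix.diagonal q).mulVec (Aᵀ.mulVec (f - A.mulVec (u k))) := by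
    ext i
    have hu : u k i = δ * shrink (v k i) μ := congrFun (hLBI.eq_smul_shrinkVec hμ k) i
    have hu' : u (k + 1) i = δ * shrink (v (k + 1) i) μ :=
      congrFun (hLBI.eq_smul_shrinkVec hμ (k + 1)) i
    rw [hstep, Pi.add_apply] at hu'
    rw [Pi.sub_apply, Pi.smul_apply, Matrix.mulVec_diagonal, smul_eq_mul, ← hshrink, hu', hu]
    ring
  refine ⟨q, hq, hdiff, ?_⟩
  rw [eq_add_of_sub_eq hdiff, Matrix.mulVec_add, Matrix.mulVec_smul, Matrix.sub_mulVec,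
    Matrix.one_mulVec, Matrix.smul_mulVec, ← Matrix.mulVec_mulVec, ← Matrix.mulVec_mulVec,
    ← neg_sub f (A.mulVec (u k))]
  simp only [Matrix.mulVec_neg, smul_neg]
  abel

end
end
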